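/- Fix real numbers δ ≤ Δ and r₁ > 0 with 2·r₁·√(max(0,Δ)) < π, and define s̃ as in the context. For D ∈ [0, r₁] let J_D = {ρ ∈ [0, r₁] : s̃(ρ, D) > D}. Then: (i) for each D, the set J_D is either empty or an interval; and (ii) if 0 ≤ D₁ < D₂ ≤ r₁, then the closure of J_{D₂} is contained in J_{D₁}. -/

import Mathlib

open scoped Real

/-- `φ₋(x) = cosh x − (sinh x)/x` for `x > 0`, and `φ₋(0) = 0`. -/
noncomputable def phiMinus (x : ℝ) : ℝ :=
  if x = 0 then 0 else Real.cosh x - Real.sinh x / x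

/-- `C₁(λ,r) = 1` if `λ ≥ 0` or `r = 0`, and `sinh(√(−λ)·r)/(√(−λ)·r)` if `λ < 0, r ≠ 0`. -/
noncomputable def C1 (lam r : ℝ) : ℝ :=
  if 0 ≤ lam ∨ r = 0 then 1
  else Real.sinh (Real.sqrt (-lam) * r) / (Real.sqrt (-lam) * r)

/-- `h(λ,r)`: equal to `√λ·r·cot(√λ·r)` for `λ > 0`, to `√(−λ)·r·coth(√(−λ)·r)` for
`λ < 0`, and to `1` when `λ = 0` or `r = 0`. -/
noncomputable def hFun (lam r : ℝ) : ℝ :=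
  if lam = 0 ∨ r = 0 then 1
  else if 0 < lam then
    Real.sqrt lam * r * (Real.cos (Real.sqrt lam * r) / Real.sin (Real.sqrt lam * r))
  else
    Real.sqrt (-lam) * r * (Real.cosh (Real.sqrt (-lam) * r) / Real.sinh (Real.sqrt (-lam) * r))

/-- `ψ(λ,r) = sign(λ)·(1 − h(λ,r))`. -/
noncomputable def psiFun (lam r : ℝ) : ℝ := Real.sign lam * (1 - hFun lam r)

/-- `ψmax(δ,Δ,r) = max(ψ(Δ,r), ψ(δ,r))`. -/
noncomputable def psiMax (δ Δ r : ℝ) : ℝ := max (psiFun Δ r) (psiFun δ r)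

/-- The contraction-constant function `κ̃(ρ,D)` of Definition 4.4 with constant
curvature bounds `δ ≤ Δ`: `κ̃(ρ,D) = φ₋((ρ+D)√K) + C₁(δ,ρ+D)·ψmax(δ,Δ,ρ+D)` where
`K = max(|δ|,|Δ|)`. -/
noncomputable def kappaT (δ Δ ρ D : ℝ) : ℝ :=
  phiMinus ((ρ + D) * Real.sqrt (max |δ| |Δ|)) + C1 δ (ρ + D) * psiMax δ Δ (ρ + D)

/-- The margin function `s̃(ρ,D) = (1 − κ̃(ρ,D))·ρ` of Definition 4.4. -/
noncomputable def sT (δ Δ ρ D : ℝ) : ℝ := (1 - kappaT δ Δ ρ D) * ρ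

open Real Set

/-- A twice differentiable function with nonnegative first and second derivatives on an open
convex set is monotone and convex there. -/
lemma monotoneOn_and_convexOn_of_hasDerivAt {S : Set ℝ} (hS : Convex ℝ S) (hO : IsOpen S)
    {f f' f'' : ℝ → ℝ} (h1 : ∀ x ∈ S, HasDerivAt f (f' x) x)
    (h2 : ∀ x ∈ S, HasDerivAt f' (f'' x) x) (h1n : ∀ x ∈ S, 0 ≤ f' x)
    (h2n : ∀ x ∈ S, 0 ≤ f'' x) : MonotoneOn f S ∧ ConvexOn ℝ S f := by
  have hc : ContinuousOn f S := fun x hx => (h1 x hx).continuousAt.continuousWithinAt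
  constructor
  · refine monotoneOn_of_deriv_nonneg hS hc (fun x hx => ?_) (fun x hx => ?_) <;>
      rw [hO.interior_eq] at hx
    · exact (h1 x hx).differentiableAt.differentiableWithinAt
    · rw [(h1 x hx).deriv]; exact h1n x hx
  · refine convexOn_of_hasDerivWithinAt2_nonneg hS hc (f' := f') (f'' := f'')
      (fun x hx => ?_) (fun x hx => ?_) (fun x hx => ?_) <;>
      rw [hO.interior_eq] at hx
    · exact (h1 x hx).hasDerivWithinAt
    · exact (h2 x hx).hasDerivWithinAt
    · exact h2n x hx

/-- A function vanishing at `0` with nonnegative derivative on `(0, b)` is nonnegative on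
`[0, b)`. -/
lemma nonneg_of_hasDerivAt {f f' : ℝ → ℝ} (h0 : f 0 = 0) (h : ∀ x, HasDerivAt f (f' x) x)
    {y : ℝ} (hy : 0 ≤ y) (hn : ∀ x, 0 < x → x < y → 0 ≤ f' x) : 0 ≤ f y := by
  have hm : MonotoneOn f (Icc 0 y) := by
    refine monotoneOn_of_deriv_nonneg (convex_Icc 0 y)
      (fun x _ => (h x).continuousAt.continuousWithinAt)
      (fun x _ => (h x).differentiableAt.differentiableWithinAt) (fun x hx => ?_)
    rw [interior_Icc] at hx
    rw [(h x).deriv]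
    exact hn x hx.1 hx.2
  simpa [h0] using hm ⟨le_rfl, hy⟩ ⟨hy, le_rfl⟩ hy

lemma sinh_le_mul_cosh {x : ℝ} (hx : 0 ≤ x) : sinh x ≤ x * cosh x := by
  have := nonneg_of_hasDerivAt (f := fun x => x * cosh x - sinh x) (f' := fun x => x * sinh x)
    (by simp) (fun x => by
      refine HasDerivAt.congr_deriv
        (((hasDerivAt_id x).mul (hasDerivAt_cosh x)).sub (hasDerivAt_sinh x)) ?_
      simp) hx (fun x hx _ => mul_nonneg hx.le (sinh_nonneg_iff.2 hx.le))
  simpa using this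

lemma mul_cos_le_sin {x : ℝ} (hx : 0 ≤ x) (hx' : x ≤ π) : x * cos x ≤ sin x := by
  have := nonneg_of_hasDerivAt (f := fun x => sin x - x * cos x) (f' := fun x => x * sin x)
    (by simp) (fun x => by
      refine HasDerivAt.congr_deriv
        ((hasDerivAt_sin x).sub ((hasDerivAt_id x).mul (hasDerivAt_cos x))) ?_
      simp) hx (fun y hy hy' =>
        mul_nonneg hy.le (sin_nonneg_of_nonneg_of_le_pi hy.le (hy'.le.trans hx')))
  simpa using this

lemma le_sinh_mul_cosh {x : ℝ} (hx : 0 ≤ x) : x ≤ sinh x * cosh x := by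
  nlinarith [self_le_sinh_iff.2 hx, one_le_cosh x, sinh_nonneg_iff.2 hx]

lemma sin_mul_cos_le {x : ℝ} (hx : 0 ≤ x) : sin x * cos x ≤ x := by
  have h := sin_le (x := 2 * x) (by positivity)
  rw [sin_two_mul] at h
  linarith

lemma hasDerivAt_sinh_div {x : ℝ} (hx : x ≠ 0) :
    HasDerivAt (fun x => sinh x / x) ((x * cosh x - sinh x) / x ^ 2) x := by
  refine HasDerivAt.congr_deriv ((hasDerivAt_sinh x).div (hasDerivAt_id x) hx) ?_
  simp; ring

lemma hasDerivAt_deriv_sinh_div {x : ℝ} (hx : x ≠ 0) :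
    HasDerivAt (fun x => (x * cosh x - sinh x) / x ^ 2)
      ((x ^ 2 * sinh x - 2 * x * cosh x + 2 * sinh x) / x ^ 3) x := by
  refine HasDerivAt.congr_deriv
    ((((hasDerivAt_id x).mul (hasDerivAt_cosh x)).sub (hasDerivAt_sinh x)).div
    (hasDerivAt_pow 2 x) (pow_ne_zero 2 hx)) ?_
  simp
  field_simp
  ring

lemma sinh_div_monotoneOn_convexOn :
    MonotoneOn (fun x => sinh x / x) (Ioi 0) ∧ ConvexOn ℝ (Ioi 0) (fun x => sinh x / x) := by
  refine monotoneOn_and_convexOn_of_hasDerivAt (convex_Ioi 0) isOpen_Ioi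
    (fun x hx => hasDerivAt_sinh_div (ne_of_gt hx))
    (fun x hx => hasDerivAt_deriv_sinh_div (ne_of_gt hx))
    (fun x (hx : 0 < x) => div_nonneg (sub_nonneg.2 (sinh_le_mul_cosh hx.le)) (by positivity))
    (fun x (hx : 0 < x) => div_nonneg ?_ (by positivity))
  refine nonneg_of_hasDerivAt (f := fun x => x ^ 2 * sinh x - 2 * x * cosh x + 2 * sinh x)
    (f' := fun x => x ^ 2 * cosh x) (by simp) (fun x => ?_) hx.le
    (fun x _ _ => mul_nonneg (sq_nonneg x) (cosh_pos x).le)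
  refine HasDerivAt.congr_deriv ((((hasDerivAt_pow 2 x).mul (hasDerivAt_sinh x)).sub
    (((hasDerivAt_id x).const_mul 2).mul (hasDerivAt_cosh x))).add
    ((hasDerivAt_sinh x).const_mul 2)) ?_
  simp
  ring

lemma phiMinus_monotoneOn_convexOn :
    MonotoneOn phiMinus (Ioi 0) ∧ ConvexOn ℝ (Ioi 0) phiMinus := by
  have heq : EqOn (fun x => cosh x - sinh x / x) phiMinus (Ioi 0) := fun x hx => by
    simp [phiMinus, ne_of_gt (show 0 < x from hx)]
  suffices h : MonotoneOn (fun x => cosh x - sinh x / x) (Ioi 0) ∧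
      ConvexOn ℝ (Ioi 0) (fun x => cosh x - sinh x / x) from ⟨h.1.congr heq, h.2.congr heq⟩
  refine monotoneOn_and_convexOn_of_hasDerivAt (convex_Ioi 0) isOpen_Ioi
    (fun x hx => (hasDerivAt_cosh x).sub (hasDerivAt_sinh_div (ne_of_gt hx)))
    (fun x hx => (hasDerivAt_sinh x).sub (hasDerivAt_deriv_sinh_div (ne_of_gt hx)))
    (fun x (hx : 0 < x) => ?_) (fun x (hx : 0 < x) => ?_)
  · have := nonneg_of_hasDerivAt (f := fun x => x ^ 2 * sinh x - (x * cosh x - sinh x))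
      (f' := fun x => x * sinh x + x ^ 2 * cosh x) (by simp) (fun x => by
        refine HasDerivAt.congr_deriv (((hasDerivAt_pow 2 x).mul (hasDerivAt_sinh x)).sub
          (((hasDerivAt_id x).mul (hasDerivAt_cosh x)).sub (hasDerivAt_sinh x))) ?_
        simp
        ring) hx.le (fun x hx _ => add_nonneg (mul_nonneg hx.le (sinh_nonneg_iff.2 hx.le))
          (mul_nonneg (sq_nonneg x) (cosh_pos x).le))
    rw [sub_nonneg, div_le_iff₀ (by positivity)]
    linarith
  · have := nonneg_of_hasDerivAt
      (f := fun x => x ^ 3 * cosh x - (x ^ 2 * sinh x - 2 * x * cosh x + 2 * sinh x))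
      (f' := fun x => 2 * x ^ 2 * cosh x + x ^ 3 * sinh x) (by simp) (fun x => by
        refine HasDerivAt.congr_deriv (((hasDerivAt_pow 3 x).mul (hasDerivAt_cosh x)).sub
          ((((hasDerivAt_pow 2 x).mul (hasDerivAt_sinh x)).sub
          (((hasDerivAt_id x).const_mul 2).mul (hasDerivAt_cosh x))).add
          ((hasDerivAt_sinh x).const_mul 2))) ?_
        simp
        ring) hx.le (fun x hx _ => add_nonneg
          (mul_nonneg (by positivity) (cosh_pos x).le)
          (mul_nonneg (by positivity) (sinh_nonneg_iff.2 hx.le)))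
    rw [sub_nonneg, div_le_iff₀ (by positivity)]
    linarith

lemma one_sub_mul_cot_monotoneOn_convexOn :
    MonotoneOn (fun x => 1 - x * (cos x / sin x)) (Ioo 0 π) ∧
      ConvexOn ℝ (Ioo 0 π) (fun x => 1 - x * (cos x / sin x)) := by
  have hs : ∀ x ∈ Ioo 0 π, 0 < sin x := fun x hx => sin_pos_of_mem_Ioo hx
  refine monotoneOn_and_convexOn_of_hasDerivAt (convex_Ioo 0 π) isOpen_Ioo
    (f' := fun x => (x - sin x * cos x) / sin x ^ 2)
    (f'' := fun x => 2 * (sin x - x * cos x) / sin x ^ 3)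
    (fun x hx => ?_) (fun x hx => ?_) (fun x hx => ?_) (fun x hx => ?_)
  · have h0 := (hs x hx).ne'
    refine HasDerivAt.congr_deriv
      (((hasDerivAt_id x).mul ((hasDerivAt_cos x).div (hasDerivAt_sin x) h0)).const_sub 1) ?_
    simp
    field_simp
    linear_combination x * sin_sq_add_cos_sq x
  · have h0 := (hs x hx).ne'
    refine HasDerivAt.congr_deriv
      (((hasDerivAt_id x).sub ((hasDerivAt_sin x).mul (hasDerivAt_cos x))).div
      ((hasDerivAt_sin x).pow 2) (pow_ne_zero 2 h0)) ?_
    simp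
    field_simp
    linear_combination sin x * sin_sq_add_cos_sq x
  · exact div_nonneg (sub_nonneg.2 (sin_mul_cos_le hx.1.le)) (sq_nonneg _)
  · exact div_nonneg (mul_nonneg zero_le_two (sub_nonneg.2 (mul_cos_le_sin hx.1.le hx.2.le)))
      (pow_nonneg (hs x hx).le 3)

lemma mul_coth_sub_one_monotoneOn_convexOn :
    MonotoneOn (fun x => x * (cosh x / sinh x) - 1) (Ioi 0) ∧
      ConvexOn ℝ (Ioi 0) (fun x => x * (cosh x / sinh x) - 1) := by
  have hs : ∀ x ∈ Ioi (0 : ℝ), 0 < sinh x := fun x hx => sinh_pos_iff.2 hx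
  refine monotoneOn_and_convexOn_of_hasDerivAt (convex_Ioi 0) isOpen_Ioi
    (f' := fun x => (sinh x * cosh x - x) / sinh x ^ 2)
    (f'' := fun x => 2 * (x * cosh x - sinh x) / sinh x ^ 3)
    (fun x hx => ?_) (fun x hx => ?_) (fun x hx => ?_) (fun x hx => ?_)
  · have h0 := (hs x hx).ne'
    refine HasDerivAt.congr_deriv
      (((hasDerivAt_id x).mul ((hasDerivAt_cosh x).div (hasDerivAt_sinh x) h0)).sub_const 1) ?_
    simp
    field_simp
    linear_combination -x * cosh_sq x
  · have h0 := (hs x hx).ne'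
    refine HasDerivAt.congr_deriv
      ((((hasDerivAt_sinh x).mul (hasDerivAt_cosh x)).sub (hasDerivAt_id x)).div
      ((hasDerivAt_sinh x).pow 2) (pow_ne_zero 2 h0)) ?_
    simp
    field_simp
    linear_combination -sinh x * cosh_sq x
  · exact div_nonneg (sub_nonneg.2 (le_sinh_mul_cosh (le_of_lt hx))) (sq_nonneg _)
  · exact div_nonneg (mul_nonneg zero_le_two (sub_nonneg.2 (sinh_le_mul_cosh (le_of_lt hx))))
      (pow_nonneg (hs x hx).le 3)

/-- Monotonicity and convexity are stable under precomposition with a nonnegative scaling. -/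
lemma monotoneOn_and_convexOn_comp_mul {S T : Set ℝ} {f : ℝ → ℝ}
    (h : MonotoneOn f T ∧ ConvexOn ℝ T f) (hS : Convex ℝ S) {a : ℝ} (ha : 0 ≤ a)
    (hST : ∀ r ∈ S, a * r ∈ T) :
    MonotoneOn (fun r => f (a * r)) S ∧ ConvexOn ℝ S (fun r => f (a * r)) := by
  refine ⟨fun x hx y hy hxy => h.1 (hST x hx) (hST y hy) (mul_le_mul_of_nonneg_left hxy ha),
    hS, fun x hx y hy s t hs ht hst => ?_⟩
  convert h.2.2 (hST x hx) (hST y hy) hs ht hst using 2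
  simp only [smul_eq_mul]
  ring

lemma C1_monotoneOn_convexOn (lam R : ℝ) :
    (∀ r ∈ Ioo 0 R, 0 ≤ C1 lam r) ∧ MonotoneOn (C1 lam) (Ioo 0 R) ∧
      ConvexOn ℝ (Ioo 0 R) (C1 lam) := by
  rcases le_or_gt 0 lam with hl | hl
  · have : C1 lam = fun _ => 1 := by ext r; simp [C1, hl]
    rw [this]
    exact ⟨fun _ _ => zero_le_one, monotoneOn_const, convexOn_const 1 (convex_Ioo 0 R)⟩
  · have ha : 0 < √(-lam) := sqrt_pos.2 (neg_pos.2 hl)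
    have heq : EqOn (fun r => sinh (√(-lam) * r) / (√(-lam) * r)) (C1 lam) (Ioo 0 R) :=
      fun r hr => by simp [C1, not_le.2 hl, hr.1.ne']
    have h := monotoneOn_and_convexOn_comp_mul sinh_div_monotoneOn_convexOn (convex_Ioo 0 R)
      ha.le (fun r hr => mul_pos ha hr.1)
    refine ⟨fun r hr => ?_, h.1.congr heq, h.2.congr heq⟩
    have hp : 0 < √(-lam) * r := mul_pos ha hr.1
    rw [← heq hr]
    exact div_nonneg (sinh_nonneg_iff.2 hp.le) hp.le

lemma psiFun_monotoneOn_convexOn {lam R : ℝ} (hR : R * √(max 0 lam) < π) :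
    (∀ r ∈ Ioo 0 R, 0 ≤ psiFun lam r) ∧ MonotoneOn (psiFun lam) (Ioo 0 R) ∧
      ConvexOn ℝ (Ioo 0 R) (psiFun lam) := by
  rcases lt_trichotomy lam 0 with hl | rfl | hl
  · have ha : 0 < √(-lam) := sqrt_pos.2 (neg_pos.2 hl)
    have heq : EqOn (fun r => √(-lam) * r * (cosh (√(-lam) * r) / sinh (√(-lam) * r)) - 1)
        (psiFun lam) (Ioo 0 R) :=
      fun r hr => by simp [psiFun, hFun, Real.sign_of_neg hl, hl.ne, hr.1.ne', not_lt.2 hl.le]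
    have h := monotoneOn_and_convexOn_comp_mul mul_coth_sub_one_monotoneOn_convexOn
      (convex_Ioo 0 R) ha.le (fun r hr => mul_pos ha hr.1)
    refine ⟨fun r hr => ?_, h.1.congr heq, h.2.congr heq⟩
    have hp : 0 < √(-lam) * r := mul_pos ha hr.1
    rw [← heq hr]
    simp only
    rw [sub_nonneg, ← mul_div_assoc, one_le_div (sinh_pos_iff.2 hp)]
    exact sinh_le_mul_cosh hp.le
  · have : psiFun 0 = fun _ => 0 := by ext r; simp [psiFun]
    rw [this]
    exact ⟨fun _ _ => le_rfl, monotoneOn_const, convexOn_const 0 (convex_Ioo 0 R)⟩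
  · have ha : 0 < √lam := sqrt_pos.2 hl
    rw [max_eq_right hl.le] at hR
    have hmem : ∀ r ∈ Ioo 0 R, √lam * r ∈ Ioo 0 π := fun r hr =>
      ⟨mul_pos ha hr.1, by nlinarith [hr.2]⟩
    have heq : EqOn (fun r => 1 - √lam * r * (cos (√lam * r) / sin (√lam * r)))
        (psiFun lam) (Ioo 0 R) :=
      fun r hr => by simp [psiFun, hFun, Real.sign_of_pos hl, hl.ne', hr.1.ne', hl]
    have h := monotoneOn_and_convexOn_comp_mul one_sub_mul_cot_monotoneOn_convexOn
      (convex_Ioo 0 R) ha.le hmem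
    refine ⟨fun r hr => ?_, h.1.congr heq, h.2.congr heq⟩
    have hp := hmem r hr
    rw [← heq hr]
    simp only
    rw [sub_nonneg, ← mul_div_assoc, div_le_one (sin_pos_of_mem_Ioo hp)]
    exact mul_cos_le_sin hp.1.le hp.2.le

lemma phiMinus_mul_monotoneOn_convexOn {a R : ℝ} (ha : 0 ≤ a) :
    MonotoneOn (fun r => phiMinus (r * a)) (Ioo 0 R) ∧
      ConvexOn ℝ (Ioo 0 R) (fun r => phiMinus (r * a)) := by
  simp only [mul_comm _ a]
  rcases ha.eq_or_lt with rfl | ha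
  · simp only [zero_mul]
    exact ⟨monotoneOn_const, convexOn_const _ (convex_Ioo 0 R)⟩
  · exact monotoneOn_and_convexOn_comp_mul phiMinus_monotoneOn_convexOn (convex_Ioo 0 R) ha.le
      (fun r hr => mul_pos ha hr.1)

/-- The contraction constant `κ̃` depends on `ρ + D` only, through a monotone convex function. -/
lemma kappaT_zero_monotoneOn_convexOn {δ Δ R : ℝ} (hδΔ : δ ≤ Δ) (hR0 : 0 ≤ R)
    (hR : R * √(max 0 Δ) < π) :
    MonotoneOn (fun r => kappaT δ Δ r 0) (Ioo 0 R) ∧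
      ConvexOn ℝ (Ioo 0 R) (fun r => kappaT δ Δ r 0) := by
  have hRδ : R * √(max 0 δ) < π :=
    (mul_le_mul_of_nonneg_left (sqrt_le_sqrt (max_le_max_left 0 hδΔ)) hR0).trans_lt hR
  obtain ⟨hΔ0, hΔm, hΔc⟩ := psiFun_monotoneOn_convexOn hR
  obtain ⟨-, hδm, hδc⟩ := psiFun_monotoneOn_convexOn hRδ
  obtain ⟨hC0, hCm, hCc⟩ := C1_monotoneOn_convexOn δ R
  obtain ⟨hφm, hφc⟩ := phiMinus_mul_monotoneOn_convexOn (R := R) (sqrt_nonneg (max |δ| |Δ|))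
  have hm : MonotoneOn (psiMax δ Δ) (Ioo 0 R) := fun x hx y hy hxy =>
    max_le_max (hΔm hx hy hxy) (hδm hx hy hxy)
  have hc : ConvexOn ℝ (Ioo 0 R) (psiMax δ Δ) := hΔc.sup hδc
  have h0 : ∀ r ∈ Ioo 0 R, 0 ≤ psiMax δ Δ r := fun r hr => (hΔ0 r hr).trans (le_max_left _ _)
  simp only [kappaT, add_zero]
  exact ⟨hφm.add (hCm.mul hm hC0 h0), hφc.add (hCc.mul hc (fun {_} h => hC0 _ h)
    (fun {_} h => h0 _ h) (hCm.monovaryOn hm))⟩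

/-- The interval and nesting properties of the sets `J_D = {ρ ∈ [0,r₁] : s̃(ρ,D) > D}`
from Lemma 4.5 of the paper: each `J_D` is empty or an interval (i.e. order-connected),
and if `D₁ < D₂` then the closure of `J_{D₂}` is contained in `J_{D₁}`. -/
theorem stmt19 (δ Δ r₁ : ℝ) (hδΔ : δ ≤ Δ) (hr₁ : 0 < r₁)
    (hreg : 2 * r₁ * Real.sqrt (max 0 Δ) < π) :
    (∀ D ∈ Set.Icc (0:ℝ) r₁,
      Set.OrdConnected {ρ : ℝ | ρ ∈ Set.Icc (0:ℝ) r₁ ∧ D < sT δ Δ ρ D}) ∧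
    (∀ D₁ D₂ : ℝ, 0 ≤ D₁ → D₁ < D₂ → D₂ ≤ r₁ →
      closure {ρ : ℝ | ρ ∈ Set.Icc (0:ℝ) r₁ ∧ D₂ < sT δ Δ ρ D₂} ⊆
        {ρ : ℝ | ρ ∈ Set.Icc (0:ℝ) r₁ ∧ D₁ < sT δ Δ ρ D₁}) := by
  obtain ⟨R, hR, hRπ⟩ : ∃ R, 2 * r₁ < R ∧ R * √(max 0 Δ) < π := by
    have hev : ∀ᶠ R in nhdsWithin (2 * r₁) (Ioi (2 * r₁)), R * √(max 0 Δ) < π :=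
      ((continuous_mul_const _).continuousAt.eventually_lt_const hreg).filter_mono
        nhdsWithin_le_nhds
    obtain ⟨R, hR⟩ := (hev.and self_mem_nhdsWithin).exists
    exact ⟨R, hR.2, hR.1⟩
  obtain ⟨hm, hc⟩ := kappaT_zero_monotoneOn_convexOn hδΔ (by linarith) hRπ
  have hκ : ∀ ρ D, kappaT δ Δ ρ D = kappaT δ Δ (ρ + D) 0 := fun ρ D => by simp [kappaT]
  have hpos : ∀ {ρ D : ℝ}, 0 ≤ D → 0 ≤ ρ → D < sT δ Δ ρ D → 0 < ρ := fun hD hρ h =>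
    hρ.lt_of_ne fun h0 => by subst h0; simp [sT] at h; linarith
  constructor
  · rintro D ⟨hD0, hD1⟩
    have hconv : ConvexOn ℝ (Ioc 0 r₁) (fun ρ => kappaT δ Δ (ρ + D) 0 + D * ρ⁻¹) := by
      have hinv : ConvexOn ℝ (Ioc 0 r₁) (fun ρ : ℝ => D * ρ⁻¹) := by
        have := (convexOn_zpow (𝕜 := ℝ) (-1)).subset
          (Ioc_subset_Ioi_self : Ioc 0 r₁ ⊆ Ioi 0) (convex_Ioc 0 r₁)
        simpa [zpow_neg_one] using this.smul hD0
      refine ConvexOn.add ⟨convex_Ioc 0 r₁, fun x hx y hy s t hs ht hst => ?_⟩ hinv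
      have hmem : ∀ x ∈ Ioc 0 r₁, x + D ∈ Ioo 0 R := fun x hx =>
        ⟨by linarith [hx.1], by linarith [hx.2]⟩
      convert hc.2 (hmem x hx) (hmem y hy) hs ht hst using 2
      simp only [smul_eq_mul]
      linear_combination -D * hst
    refine (congrArg OrdConnected (Set.ext fun ρ => ?_)).mpr (hconv.convex_lt 1).ordConnected
    have hiff : 0 < ρ → (D < sT δ Δ ρ D ↔ kappaT δ Δ (ρ + D) 0 + D * ρ⁻¹ < 1) := fun h => by
      rw [sT, hκ, ← div_lt_iff₀ h, div_eq_mul_inv, lt_sub_iff_add_lt, add_comm]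
    constructor
    · rintro ⟨h, hs⟩
      have h0 := hpos hD0 h.1 hs
      exact ⟨⟨h0, h.2⟩, (hiff h0).1 hs⟩
    · rintro ⟨h, hs⟩
      exact ⟨⟨h.1.le, h.2⟩, (hiff h.1).2 hs⟩
  · intro D₁ D₂ h1 h12 h2 ρ hρ
    have hρI : ρ ∈ Icc 0 r₁ := closure_minimal (fun _ h => h.1) isClosed_Icc hρ
    have hD₂ : 0 < D₂ := h1.trans_lt h12
    have hmem : ρ + D₂ ∈ Ioo 0 R := ⟨by linarith [hρI.1], by linarith [hρI.2]⟩
    have hcont : ContinuousAt (fun ρ => sT δ Δ ρ D₂) ρ := by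
      have hk : ContinuousAt (fun r => kappaT δ Δ r 0) (ρ + D₂) :=
        (hc.continuousOn isOpen_Ioo).continuousAt (isOpen_Ioo.mem_nhds hmem)
      have hk' : ContinuousAt (fun ρ => kappaT δ Δ (ρ + D₂) 0) ρ :=
        hk.comp (f := fun ρ => ρ + D₂) (continuous_add_const D₂).continuousAt
      simp only [sT, hκ _ D₂]
      exact (continuousAt_const.sub hk').mul continuousAt_id
    have hle : D₂ ≤ sT δ Δ ρ D₂ := by
      have hcl := hcont.continuousWithinAt.mem_closure_image hρ
      refine closure_minimal (t := Ici D₂) ?_ isClosed_Ici hcl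
      rintro _ ⟨x, hx, rfl⟩
      exact hx.2.le
    have hρ0 : 0 < ρ := hρI.1.lt_of_ne fun h0 => by subst h0; simp [sT] at hle; linarith
    refine ⟨hρI, h12.trans_le (hle.trans ?_)⟩
    have := hm (a := ρ + D₁) (b := ρ + D₂) ⟨by linarith, by linarith [hmem.2]⟩ hmem
      (by linarith)
    rw [sT, sT, hκ, hκ ρ D₁]
    exact mul_le_mul_of_nonneg_right (sub_le_sub_left this 1) hρ0.le
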